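/- Let k be an algebraically closed field of characteristic zero and f ∈ k[x_1, …, x_n] a nonconstant polynomial such that the hypersurface {f = 0} is smooth, i.e. f, ∂f/∂x_1, …, ∂f/∂x_n have no common zero in k^n. Then n is a uniform Artin–Rees number for f: for every ideal 𝔟 ⊆ k[x_1,…,x_n] and every integer m ≥ n, 𝔟^m ∩ (f) ⊆ 𝔟^{m−n}·(f). -/

import Mathlib

open MvPolynomial

theorem Ideal.span_range_pow_le_span_frobenius {R : Type*} [CommRing R] {n : ℕ} (y : Fin n → R)
    {q j N : ℕ} (hq : 0 < q) (hN : q * j + n * (q - 1) < N + q) :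
    Ideal.span (Set.range y) ^ N ≤
      Ideal.span ((· ^ q) '' (Ideal.span (Set.range y) ^ j : Ideal R)) := by
  set I := Ideal.span (Set.range y) with hI
  intro z hz
  rw [hI, Ideal.mem_span_pow_iff_exists_isHomogeneous] at hz
  obtain ⟨P, hP, rfl⟩ := hz
  rw [eval_eq']
  refine Ideal.sum_mem _ fun d hd => Ideal.mul_mem_left _ _ ?_
  have hdeg : ∑ i, d i = N := by
    have := hP (mem_support_iff.mp hd)
    rw [← this, Finsupp.weight_apply, Finsupp.sum_fintype] <;> simp
  have h1 : ∀ i, d i = q * (d i / q) + d i % q := fun i => (Nat.div_add_mod _ _).symm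
  have h2 : ∑ i, d i ≤ q * ∑ i, d i / q + n * (q - 1) := by
    calc ∑ i, d i = q * ∑ i, d i / q + ∑ i, d i % q := by
          rw [Finset.mul_sum, ← Finset.sum_add_distrib]; exact Finset.sum_congr rfl fun i _ => h1 i
      _ ≤ _ := by
          gcongr
          calc ∑ i, d i % q ≤ ∑ _i : Fin n, (q - 1) :=
                Finset.sum_le_sum fun i _ => Nat.le_sub_one_of_lt (Nat.mod_lt _ hq)
            _ = _ := by simp
  have h3 : j ≤ ∑ i, d i / q := by
    by_contra h
    have : q * (∑ i, d i / q + 1) ≤ q * j := Nat.mul_le_mul_left _ (by omega)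
    rw [mul_add] at this
    omega
  have h4 : ∏ i, y i ^ d i = (∏ i, y i ^ (d i % q)) * (∏ i, y i ^ (d i / q)) ^ q := by
    rw [← Finset.prod_pow, ← Finset.prod_mul_distrib]
    refine Finset.prod_congr rfl fun i _ => ?_
    rw [← pow_mul, ← pow_add, add_comm, mul_comm, Nat.div_add_mod]
  rw [h4]
  refine Ideal.mul_mem_left _ _ (Ideal.subset_span (Set.mem_image_of_mem (· ^ q) ?_))
  refine Ideal.pow_le_pow_right h3 ?_
  rw [← Finset.prod_pow_eq_pow_sum]
  exact Ideal.prod_mem_prod fun i _ =>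
    Ideal.pow_mem_pow (Ideal.subset_span (Set.mem_range_self i)) _

namespace MvPolynomial

theorem mem_of_mul_mem_of_idealOfVars_pow_le {σ k : Type*} [Field k] {J : Ideal (MvPolynomial σ k)}
    {L : ℕ} (hJ : idealOfVars σ k ^ L ≤ J) {g u : MvPolynomial σ k} (hu : u.coeff 0 ≠ 0)
    (h : g * u ∈ J) : g ∈ J := by
  have h1 : IsCoprime (Ideal.span {u}) (idealOfVars σ k) := by
    rw [Ideal.isCoprime_iff_exists]
    refine ⟨C (u.coeff 0)⁻¹ * u, Ideal.mul_mem_left _ _ (Ideal.mem_span_singleton_self _),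
      1 - C (u.coeff 0)⁻¹ * u, ?_, by ring⟩
    rw [← pow_one (idealOfVars σ k), mem_pow_idealOfVars_iff']
    intro x hx
    obtain rfl : x = 0 := by simpa [Finsupp.degree_eq_zero_iff] using hx
    simp [coeff_C_mul, hu]
  obtain ⟨a, ha, c, hc, hac⟩ := Ideal.isCoprime_iff_exists.mp (h1.pow_right (n := L))
  obtain ⟨r, rfl⟩ := Ideal.mem_span_singleton'.mp ha
  have : g = r * (g * u) + g * c := by linear_combination g * (-hac)
  rw [this]
  exact J.add_mem (J.mul_mem_left _ h) (J.mul_mem_left _ (hJ hc))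

theorem coeff_single_pow {σ R : Type*} [CommRing R] {f : MvPolynomial σ R}
    (hf : f.coeff 0 = 0) (i : σ) (N : ℕ) :
    (f ^ N).coeff (Finsupp.single i N) = f.coeff (Finsupp.single i 1) ^ N := by
  classical
  induction N with
  | zero => simp
  | succ N ih =>
    have hN : f ^ N ∈ idealOfVars σ R ^ N := by
      refine Ideal.pow_mem_pow ?_ _
      rw [← pow_one (idealOfVars σ R), mem_pow_idealOfVars_iff']
      intro x hx
      obtain rfl : x = 0 := by simpa [Finsupp.degree_eq_zero_iff] using hx
      exact hf
    rw [mem_pow_idealOfVars_iff'] at hN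
    rw [pow_succ, coeff_mul, Finsupp.antidiagonal_single, Finset.sum_map,
      Finset.sum_eq_single (N, 1)]
    · simp [ih, pow_succ]
    · rintro ⟨a, b⟩ hab hne
      replace hab : a + b = N + 1 := by simpa using hab
      rcases Nat.eq_zero_or_pos b with rfl | hb
      · simp [hf]
      · have : a < N := by
          rcases Nat.lt_or_ge a N with h | h
          · exact h
          · exact absurd (Prod.ext (by simp; omega) (by simp; omega)) hne
        simp [hN (Finsupp.single i a) (by simpa using this)]
    · intro h; simp at h

theorem exists_cartier_addMonoidHom {σ κ : Type*} [Field κ] (p : ℕ) [Fact p.Prime] [CharP κ p]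
    [PerfectField κ] (e : ℕ) (a : σ →₀ ℕ) (ha : ∀ i, a i < p ^ e) :
    ∃ ψ : MvPolynomial σ κ →+ MvPolynomial σ κ,
      (∀ s, (ψ s).coeff 0 ^ p ^ e = s.coeff a) ∧ ∀ w s, ψ (w ^ p ^ e * s) = w * ψ s := by
  classical
  have : ExpChar κ p := .prime Fact.out
  have : PerfectRing κ p := PerfectField.toPerfectRing p
  set F := iterateFrobeniusEquiv κ p e
  have hq : 0 < p ^ e := pow_pos (Nat.Prime.pos Fact.out) _
  have hinj : Function.Injective fun β : σ →₀ ℕ => a + p ^ e • β := by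
    intro x y hxy
    ext i
    have := DFunLike.congr_fun hxy i
    simpa only [Finsupp.add_apply, Finsupp.smul_apply, smul_eq_mul, add_right_inj,
      Nat.mul_right_inj hq.ne'] using this
  have hex : ∀ s : MvPolynomial σ κ, ∃ t : MvPolynomial σ κ,
      ∀ β, t.coeff β = F.symm (s.coeff (a + p ^ e • β)) := by
    intro s
    refine ⟨∑ γ ∈ s.support.preimage _ hinj.injOn, monomial γ (F.symm (s.coeff (a + p ^ e • γ))),
      fun β => ?_⟩
    rw [coeff_sum]
    simp only [coeff_monomial, Finset.sum_ite_eq', Finset.mem_preimage, mem_support_iff]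
    split_ifs with h
    · rfl
    · rw [not_not.mp h, map_zero]
  choose ψ hψ using hex
  refine ⟨⟨⟨ψ, ?_⟩, ?_⟩, ?_, ?_⟩
  · ext β; simp [hψ]
  · intro x y; ext β; simp [hψ]
  · intro s
    change (ψ s).coeff 0 ^ p ^ e = _
    rw [hψ, ← iterateFrobeniusEquiv_def κ p e, smul_zero, add_zero, RingEquiv.apply_symm_apply]
  · intro w s
    change ψ _ = _ * ψ _
    induction w using MvPolynomial.induction_on' with
    | add w₁ w₂ h₁ h₂ =>
      have hadd : ∀ x y, ψ (x + y) = ψ x + ψ y := fun x y => by ext β; simp [hψ]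
      rw [add_pow_char_pow, add_mul, hadd, h₁, h₂, add_mul]
    | monomial u c =>
      ext β
      rw [hψ, monomial_pow, coeff_monomial_mul', coeff_monomial_mul', hψ]
      have hle : p ^ e • u ≤ a + p ^ e • β ↔ u ≤ β := by
        refine forall_congr' fun i => ?_
        simp only [Finsupp.add_apply, Finsupp.smul_apply, smul_eq_mul]
        constructor
        · intro h
          have := ha i
          by_contra! hlt
          have := Nat.mul_le_mul_left (p ^ e) (Nat.succ_le_of_lt hlt)
          rw [Nat.mul_succ] at this
          omega
        · intro h
          exact (Nat.mul_le_mul_left _ h).trans (Nat.le_add_left _ _)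
      simp only [hle]
      split_ifs with h
      · rw [← iterateFrobeniusEquiv_def κ p e, map_mul, RingEquiv.symm_apply_apply]
        congr 3
        obtain ⟨v, rfl⟩ := exists_add_of_le h
        rw [smul_add, add_left_comm, add_tsub_cancel_left, add_tsub_cancel_left]
      · simp

end MvPolynomial

namespace MvPolynomial

theorem exists_isHomogeneous_aeval_mem_idealOfVars_mul {κ : Type*} [Field κ] {n L : ℕ}
    {b : Ideal (MvPolynomial (Fin n) κ)} (hL : idealOfVars (Fin n) κ ^ L ≤ b)
    (hb : b ≤ idealOfVars (Fin n) κ) (y : Fin (n + 1) → MvPolynomial (Fin n) κ)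
    (hy : ∀ i, y i ∈ b) :
    ∃ (d : ℕ) (P : MvPolynomial (Fin (n + 1)) κ), P ≠ 0 ∧ P.IsHomogeneous d ∧
      aeval y P ∈ idealOfVars (Fin n) κ * b ^ d := by
  by_contra! hno
  have hmem : ∀ (d : ℕ) (P : MvPolynomial (Fin (n + 1)) κ), P.IsHomogeneous d →
      aeval y P ∈ b ^ d := by
    intro d P hP
    rw [aeval_def, eval₂_eq']
    refine Ideal.sum_mem _ fun α hα => Ideal.mul_mem_left _ _ ?_
    have hdeg : ∑ i, α i = d := by
      have := hP (mem_support_iff.mp hα)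
      rw [← this, Finsupp.weight_apply, Finsupp.sum_fintype] <;> simp
    rw [← hdeg, ← Finset.prod_pow_eq_pow_sum]
    exact Ideal.prod_mem_prod fun i _ => Ideal.pow_mem_pow (hy i) _
  have hcomp : ∀ (N : ℕ) (Q : MvPolynomial (Fin (n + 1)) κ), aeval y Q ∈ b ^ N →
      ∀ i < N, homogeneousComponent i Q = 0 := by
    intro N Q hQ i
    induction i using Nat.strong_induction_on with
    | _ i ih =>
      intro hi
      by_contra hne
      refine hno i _ hne (homogeneousComponent_isHomogeneous i Q) ?_
      have h1 : b ^ (i + 1) ≤ idealOfVars (Fin n) κ * b ^ i := by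
        rw [pow_succ']; exact Ideal.mul_mono_left hb
      apply h1
      have h2 : homogeneousComponent i Q = Q -
          ∑ j ∈ (Finset.range (Q.totalDegree + 1)).erase i, homogeneousComponent j Q := by
        rw [eq_sub_iff_add_eq]
        by_cases hir : i ∈ Finset.range (Q.totalDegree + 1)
        · rw [Finset.add_sum_erase _ (fun j => homogeneousComponent j Q) hir,
            sum_homogeneousComponent]
        · rw [Finset.erase_eq_of_notMem hir, sum_homogeneousComponent,
            homogeneousComponent_eq_zero, zero_add]
          simpa [Nat.lt_succ_iff] using hir
      rw [h2, map_sub, map_sum]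
      refine Ideal.sub_mem _ (Ideal.pow_le_pow_right (by omega) hQ) (Ideal.sum_mem _ fun j hj => ?_)
      rcases lt_trichotomy j i with h | h | h
      · rw [ih j h (h.trans hi), map_zero]; exact Ideal.zero_mem _
      · simp [h] at hj
      · exact Ideal.pow_le_pow_right h (hmem j _ (homogeneousComponent_isHomogeneous j Q))
  set K := (L * (n + 1)) ^ n + 1 with hK
  set N := (n + 1) * K with hN
  set M := L * N with hM
  let expo : (Fin (n + 1) → Fin K) → (Fin (n + 1) →₀ ℕ) :=
    fun α => Finsupp.equivFunOnFinite.symm fun i => (α i : ℕ)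
  let poly : ((Fin (n + 1) → Fin K) → κ) →ₗ[κ] MvPolynomial (Fin (n + 1)) κ :=
    ∑ α, (monomial (expo α)).comp (LinearMap.proj α)
  let coefs : MvPolynomial (Fin n) κ →ₗ[κ] ((Fin n → Fin M) → κ) :=
    LinearMap.pi fun β => lcoeff κ (Finsupp.equivFunOnFinite.symm fun i => (β i : ℕ))
  have hlt : Module.finrank κ ((Fin n → Fin M) → κ) <
      Module.finrank κ ((Fin (n + 1) → Fin K) → κ) := by
    simp only [Module.finrank_fintype_fun_eq_card, Fintype.card_pi, Fintype.card_fin,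
      Finset.prod_const, Finset.card_univ]
    rw [hM, hN, ← mul_assoc, mul_pow, pow_succ' K, hK]
    exact Nat.mul_lt_mul_of_pos_right (Nat.lt_succ_self _) (by positivity)
  have hker := LinearMap.ker_ne_bot_of_finrank_lt
    (f := coefs.comp ((aeval y).toLinearMap.comp poly)) hlt
  obtain ⟨c, hc, hc0⟩ := Submodule.exists_mem_ne_zero_of_ne_bot hker
  have hexpo : Function.Injective expo := by
    intro α β h
    have := Finsupp.equivFunOnFinite.symm.injective h
    ext i
    exact congrFun this i
  have hcoeff : ∀ α, (poly c).coeff (expo α) = c α := by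
    intro α
    simp [poly, coeff_sum, coeff_monomial, hexpo.eq_iff]
  have hyN : aeval y (poly c) ∈ b ^ N := by
    have : idealOfVars (Fin n) κ ^ M ≤ b ^ N := by
      rw [hM, pow_mul]; exact Ideal.pow_right_mono hL _
    apply this
    rw [mem_pow_idealOfVars_iff']
    intro x hx
    have hxi : ∀ i, x i < M := fun i => (Finsupp.le_degree i x).trans_lt hx
    have := congrFun (LinearMap.mem_ker.mp hc) fun i => ⟨x i, hxi i⟩
    simp [coefs] at this
    convert this
    ext i; simp
  apply hc0
  ext α
  have hdeg : (expo α).degree < N := by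
    rw [Finsupp.degree_eq_sum, hN]
    calc ∑ i, expo α i < ∑ i : Fin (n + 1), K :=
          Finset.sum_lt_sum_of_nonempty Finset.univ_nonempty fun i _ => (α i).2
      _ = _ := by simp
  have := congrArg (coeff (expo α)) (hcomp N _ hyN _ hdeg)
  rw [coeff_homogeneousComponent, if_pos rfl, hcoeff] at this
  simpa using this

end MvPolynomial

namespace MvPolynomial

theorem IsHomogeneous.exists_eval_ne_zero_of_infinite {κ : Type*} [Field κ] [Infinite κ] {n d : ℕ}
    {P : MvPolynomial (Fin (n + 1)) κ} (hP : P.IsHomogeneous d) (h0 : P ≠ 0) :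
    ∃ l : Fin (n + 1) → κ, l (Fin.last n) = 1 ∧ eval l P ≠ 0 := by
  have hne : X (Fin.last n) * P ≠ 0 := mul_ne_zero (X_ne_zero _) h0
  obtain ⟨a, ha⟩ : ∃ a, eval a (X (Fin.last n) * P) ≠ 0 := by
    by_contra! h
    exact hne (MvPolynomial.funext fun x => by rw [h, map_zero])
  rw [map_mul, eval_X] at ha
  have ha0 : a (Fin.last n) ≠ 0 := left_ne_zero_of_mul ha
  refine ⟨fun i => (a (Fin.last n))⁻¹ * a i, inv_mul_cancel₀ ha0, ?_⟩
  have heval : MvPolynomial.eval (fun i => (a (Fin.last n))⁻¹ * a i) P =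
      (a (Fin.last n))⁻¹ ^ d * MvPolynomial.eval a P := by
    rw [eval_eq, eval_eq, Finset.mul_sum]
    refine Finset.sum_congr rfl fun α hα => ?_
    have hdeg : α.degree = d := by
      rw [← hP (mem_support_iff.mp hα), Finsupp.degree_eq_weight_one, Pi.one_def]
    rw [Finset.prod_congr rfl fun i _ => mul_pow _ _ _, Finset.prod_mul_distrib,
      Finset.prod_pow_eq_pow_sum, ← Finsupp.degree_apply, hdeg]
    ring
  rw [heval]
  exact mul_ne_zero (pow_ne_zero _ (inv_ne_zero ha0)) (right_ne_zero_of_mul ha)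

theorem IsHomogeneous.aeval_sub_eval_smul_mem {κ R σ : Type*} [Field κ] [CommRing R] [Algebra κ R]
    {d : ℕ} {P : MvPolynomial σ κ} (hP : P.IsHomogeneous (d + 1)) (l : σ → κ) (y : σ → R) (v : R)
    {Z b : Ideal R} (hZ : ∀ i, y i - l i • v ∈ Z) (hb : ∀ i, y i ∈ b) (hv : v ∈ b) :
    MvPolynomial.aeval y P - MvPolynomial.eval l P • v ^ (d + 1) ∈ Z * b ^ d := by
  have key : ∀ (d : ℕ) (α : σ →₀ ℕ), α.degree = d + 1 →
      (α.prod fun i e => y i ^ e) - (α.prod fun i e => l i ^ e) • v ^ (d + 1) ∈ Z * b ^ d := by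
    intro d
    induction d with
    | zero =>
      intro α hα
      have hne : α ≠ 0 := by rintro rfl; simp at hα
      obtain ⟨i, hi⟩ := Finsupp.ne_iff.mp hne
      obtain ⟨β, rfl⟩ : ∃ β, α = Finsupp.single i 1 + β :=
        exists_add_of_le (Finsupp.single_le_iff.mpr (Nat.one_le_iff_ne_zero.mpr hi))
      obtain rfl : β = 0 := by simpa [Finsupp.degree_eq_zero_iff] using hα
      simpa using hZ i
    | succ d ih =>
      intro α hα
      have hne : α ≠ 0 := by rintro rfl; simp at hα
      obtain ⟨i, hi⟩ := Finsupp.ne_iff.mp hne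
      obtain ⟨β, rfl⟩ : ∃ β, α = Finsupp.single i 1 + β :=
        exists_add_of_le (Finsupp.single_le_iff.mpr (Nat.one_le_iff_ne_zero.mpr hi))
      have hβ : β.degree = d + 1 := by
        rw [map_add, Finsupp.degree_single] at hα; omega
      classical
      rw [Finsupp.prod_add_index' (by simp) (by simp [pow_add]),
        Finsupp.prod_add_index' (by simp) (by simp [pow_add])]
      simp only [Finsupp.prod_single_index, pow_zero, pow_one]
      set A := β.prod fun i e => y i ^ e
      set B := β.prod fun i e => l i ^ e
      have h1 : y i * A - (l i * B) • v ^ (d + 1 + 1) =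
          y i * (A - B • v ^ (d + 1)) + (y i - l i • v) * (B • v ^ (d + 1)) := by
        simp only [Algebra.smul_def, map_mul]; ring
      rw [h1]
      refine Ideal.add_mem _ ?_ (Ideal.mul_mem_mul (hZ i) ?_)
      · have := Ideal.mul_mem_mul (hb i) (ih β hβ)
        convert this using 1
        ring
      · rw [Algebra.smul_def]
        exact Ideal.mul_mem_left _ _ (Ideal.pow_mem_pow hv _)
  rw [aeval_def, eval₂_eq, eval_eq, Finset.sum_smul, ← Finset.sum_sub_distrib]
  refine Ideal.sum_mem _ fun α hα => ?_
  have hdeg : α.degree = d + 1 := by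
    rw [← hP (mem_support_iff.mp hα), Finsupp.degree_eq_weight_one, Pi.one_def]
  have := Ideal.mul_mem_left _ (algebraMap κ R (coeff α P)) (key d α hdeg)
  convert this using 1
  simp only [Finsupp.prod, Algebra.smul_def, map_mul]
  ring

end MvPolynomial

theorem Ideal.pow_add_le_pow_add_pow_of_pow_succ_le {R : Type*} [CommRing R] {b Z a : Ideal R}
    {s : ℕ} (h : b ^ (s + 1) ≤ Z * b ^ s + a * b ^ (s + 1)) (N T : ℕ) :
    b ^ (s + N) ≤ Z ^ N + a ^ T := by
  have h1 : b ^ (s + 1) ≤ Z * b ^ s + a ^ T := by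
    have : b ^ (s + 1) ≤ Z * b ^ s + a ^ T * b ^ (s + 1) := by
      induction T with
      | zero => simp
      | succ T ih =>
        calc b ^ (s + 1) ≤ Z * b ^ s + a ^ T * b ^ (s + 1) := ih
          _ ≤ Z * b ^ s + a ^ T * (Z * b ^ s + a * b ^ (s + 1)) := by gcongr
          _ = (Z * b ^ s + a ^ T * (Z * b ^ s)) + a ^ (T + 1) * b ^ (s + 1) := by ring
          _ ≤ _ := by
            gcongr
            exact sup_le le_rfl Ideal.mul_le_right
    exact this.trans (by gcongr; exact Ideal.mul_le_left)
  induction N with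
  | zero => simp
  | succ N ih =>
    calc b ^ (s + (N + 1)) = b ^ N * b ^ (s + 1) := by ring
      _ ≤ b ^ N * (Z * b ^ s + a ^ T) := by gcongr
      _ = Z * b ^ (s + N) + b ^ N * a ^ T := by ring
      _ ≤ Z * (Z ^ N + a ^ T) + a ^ T := by gcongr; exact Ideal.mul_le_right
      _ = Z ^ (N + 1) + (Z * a ^ T + a ^ T) := by ring
      _ ≤ _ := by
        gcongr
        exact sup_le Ideal.mul_le_right le_rfl

theorem Ideal.pow_succ_le_of_pow_mem {R : Type*} [CommRing R] {b Z a : Ideal R} {v : R}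
    (hv : v ∈ b) {s d : ℕ}
    (h : b ^ (s + 1) ≤ (Z + Ideal.span {v}) * b ^ s + a * b ^ (s + 1))
    (hvd : v ^ (d + 1) ∈ Z * b ^ d + a * b ^ (d + 1)) :
    b ^ (s + d + 1) ≤ Z * b ^ (s + d) + a * b ^ (s + d + 1) := by
  set V := Ideal.span {v} with hV
  have hVb : V ≤ b := (Ideal.span_singleton_le_iff_mem _).mpr hv
  have hVd : V ^ (d + 1) ≤ Z * b ^ d + a * b ^ (d + 1) := by
    rw [hV, Ideal.span_singleton_pow]; exact (Ideal.span_singleton_le_iff_mem _).mpr hvd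
  have key : ∀ N, b ^ (s + N + 1) ≤
      Z * b ^ (s + N) + V ^ (N + 1) * b ^ s + a * b ^ (s + N + 1) := by
    intro N
    induction N with
    | zero => refine h.trans_eq ?_; ring
    | succ N ih =>
      calc b ^ (s + (N + 1) + 1) = b * b ^ (s + N + 1) := by ring
        _ ≤ b * (Z * b ^ (s + N) + V ^ (N + 1) * b ^ s + a * b ^ (s + N + 1)) := by gcongr
        _ = Z * b ^ (s + N + 1) + V ^ (N + 1) * b ^ (s + 1) + a * b ^ (s + N + 1 + 1) := by ring
        _ ≤ Z * b ^ (s + N + 1) + V ^ (N + 1) * ((Z + V) * b ^ s + a * b ^ (s + 1))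
            + a * b ^ (s + N + 1 + 1) := by gcongr
        _ = Z * b ^ (s + N + 1) + Z * (V ^ (N + 1) * b ^ s) + V ^ (N + 1 + 1) * b ^ s
            + a * (V ^ (N + 1) * b ^ (s + 1)) + a * b ^ (s + N + 1 + 1) := by ring
        _ ≤ Z * b ^ (s + N + 1) + Z * (b ^ (N + 1) * b ^ s) + V ^ (N + 1 + 1) * b ^ s
            + a * (b ^ (N + 1) * b ^ (s + 1)) + a * b ^ (s + N + 1 + 1) := by gcongr
        _ = (Z * b ^ (s + N + 1) + Z * b ^ (s + N + 1)) + V ^ (N + 1 + 1) * b ^ s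
            + (a * b ^ (s + N + 1 + 1) + a * b ^ (s + N + 1 + 1)) := by ring
        _ = _ := by simp only [Submodule.add_eq_sup, sup_idem]; rfl
  calc b ^ (s + d + 1) ≤ Z * b ^ (s + d) + V ^ (d + 1) * b ^ s + a * b ^ (s + d + 1) := key d
    _ ≤ Z * b ^ (s + d) + (Z * b ^ d + a * b ^ (d + 1)) * b ^ s + a * b ^ (s + d + 1) := by gcongr
    _ = (Z * b ^ (s + d) + Z * b ^ (s + d)) + (a * b ^ (s + d + 1) + a * b ^ (s + d + 1)) := by ring
    _ = _ := by simp only [Submodule.add_eq_sup, sup_idem]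

namespace MvPolynomial

theorem exists_reduction_of_idealOfVars_pow_le {κ : Type*} [Field κ] [Infinite κ] {n L : ℕ}
    {b : Ideal (MvPolynomial (Fin n) κ)} (hL : idealOfVars (Fin n) κ ^ L ≤ b)
    (hb : b ≤ idealOfVars (Fin n) κ) :
    ∃ (z : Fin n → MvPolynomial (Fin n) κ) (s : ℕ), (∀ i, z i ∈ b) ∧
      b ^ (s + 1) ≤ Ideal.span (Set.range z) * b ^ s + idealOfVars (Fin n) κ * b ^ (s + 1) := by
  let E : ℕ → Prop := fun r => ∃ (w : Fin r → MvPolynomial (Fin n) κ) (s : ℕ), (∀ i, w i ∈ b) ∧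
      b ^ (s + 1) ≤ Ideal.span (Set.range w) * b ^ s + idealOfVars (Fin n) κ * b ^ (s + 1)
  change E n
  have hdown : ∀ r, n ≤ r → E (r + 1) → E r := by
    rintro r hr ⟨w, s, hw, hs⟩
    let ι : Fin (n + 1) → Fin (r + 1) := Fin.lastCases (Fin.last r) fun i => Fin.castSucc (i.castLE hr)
    have hιlast : ι (Fin.last n) = Fin.last r := by simp [ι]
    have hιcast : ∀ i : Fin n, ι i.castSucc = (i.castLE hr).castSucc := by simp [ι]
    set v := w (Fin.last r) with hv
    obtain ⟨d, P, hP0, hP, hPmem⟩ := exists_isHomogeneous_aeval_mem_idealOfVars_mul hL hb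
      (fun i => w (ι i)) (fun i => hw _)
    obtain ⟨l, hl, hlP⟩ := hP.exists_eval_ne_zero_of_infinite hP0
    have hPX : (P * X (Fin.last n)).IsHomogeneous (d + 1) := hP.mul (isHomogeneous_X _ _)
    let μ : Fin r → κ := fun i => if h : (i : ℕ) < n then l (Fin.castSucc ⟨i, h⟩) else 0
    let z : Fin r → MvPolynomial (Fin n) κ := fun i => w i.castSucc - μ i • v
    have hvb : v ∈ b := hw _
    have hzb : ∀ i, z i ∈ b := fun i => b.sub_mem (hw _) (by
      rw [Algebra.smul_def]; exact b.mul_mem_left _ hvb)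
    set Z := Ideal.span (Set.range z) with hZ
    refine ⟨z, s + d, hzb, Ideal.pow_succ_le_of_pow_mem (v := v) hvb ?_ ?_⟩
    · refine hs.trans ?_
      gcongr
      rw [Ideal.span_le]
      rintro _ ⟨i, rfl⟩
      have hvm : v ∈ Z + Ideal.span {v} :=
        Ideal.mem_sup_right (Ideal.mem_span_singleton_self v)
      induction i using Fin.lastCases with
      | last => exact hvm
      | cast i =>
        have h1 : w i.castSucc = z i + μ i • v := by simp [z]
        rw [h1, Algebra.smul_def]
        exact Ideal.add_mem _ (Ideal.mem_sup_left (Ideal.subset_span ⟨i, rfl⟩))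
          (Ideal.mul_mem_left _ _ hvm)
    · have hsub := hPX.aeval_sub_eval_smul_mem l (fun i => w (ι i)) v (Z := Z) (b := b) (fun i => by
        induction i using Fin.lastCases with
        | last => simp [hιlast, hl, hv]
        | cast i =>
          refine Ideal.subset_span ⟨i.castLE hr, ?_⟩
          simp [z, μ, hιcast]
          rfl) (fun i => hw _) hvb
      have hev : eval l (P * X (Fin.last n)) = eval l P := by simp [hl]
      have hmem : aeval (fun i => w (ι i)) (P * X (Fin.last n)) ∈
          idealOfVars (Fin n) κ * b ^ (d + 1) := by
        rw [map_mul, aeval_X, pow_succ, ← mul_assoc]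
        exact Ideal.mul_mem_mul hPmem (hw _)
      rw [hev] at hsub
      have h2 : v ^ (d + 1) = C (eval l P)⁻¹ * (eval l P • v ^ (d + 1)) := by
        rw [Algebra.smul_def, algebraMap_eq, ← mul_assoc, ← C_mul, inv_mul_cancel₀ hlP, C_1, one_mul]
      rw [h2]
      refine Ideal.mul_mem_left _ _ ?_
      have h3 := Ideal.sub_mem (Z * b ^ d + idealOfVars (Fin n) κ * b ^ (d + 1))
        (Ideal.mem_sup_right hmem) (Ideal.mem_sup_left hsub)
      rwa [sub_sub_cancel] at h3
  obtain ⟨r, w, hwb⟩ := Submodule.fg_iff_exists_fin_generating_family.mp (IsNoetherian.noetherian b)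
  have hwb' : Ideal.span (Set.range w) = b := hwb
  have hstart : E (r + n) := by
    refine ⟨Fin.append w 0, 0, fun i => ?_, ?_⟩
    · induction i using Fin.addCases with
      | left i => rw [Fin.append_left, ← hwb']; exact Ideal.subset_span ⟨i, rfl⟩
      | right i => rw [Fin.append_right]; exact b.zero_mem
    · rw [zero_add, pow_one, pow_zero, mul_one]
      refine le_trans ?_ le_sup_left
      conv_lhs => rw [← hwb']
      refine Ideal.span_mono ?_
      rintro _ ⟨i, rfl⟩
      exact ⟨Fin.castAdd n i, Fin.append_left _ _ _⟩
  clear hwb hwb' w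
  induction r with
  | zero => simpa using hstart
  | succ r ih =>
    refine ih (hdown _ (Nat.le_add_left _ _) ?_)
    convert hstart using 1
    ring

theorem mem_pow_of_mul_mem_pow_of_charP {κ : Type*} [Field κ] [Infinite κ] [PerfectField κ]
    (p : ℕ) [Fact p.Prime] [CharP κ p] {n L : ℕ} {b : Ideal (MvPolynomial (Fin n) κ)}
    (hL : idealOfVars (Fin n) κ ^ L ≤ b) {f g : MvPolynomial (Fin n) κ} (hf : f.coeff 0 = 0)
    {i : Fin n} (hi : f.coeff (Finsupp.single i 1) ≠ 0) {m : ℕ} (hm : n ≤ m)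
    (hfg : f * g ∈ b ^ m) : g ∈ b ^ (m - n) := by
  by_cases hb : b ≤ idealOfVars (Fin n) κ
  swap
  · obtain ⟨u, hu, hu0⟩ := SetLike.not_le_iff_exists.mp hb
    have hu1 : u.coeff 0 ≠ 0 := by
      contrapose! hu0
      rw [← pow_one (idealOfVars (Fin n) κ), mem_pow_idealOfVars_iff']
      intro x hx
      obtain rfl : x = 0 := by simpa [Finsupp.degree_eq_zero_iff] using hx
      exact hu0
    have h1 : (1 : MvPolynomial (Fin n) κ) ∈ b :=
      mem_of_mul_mem_of_idealOfVars_pow_le hL hu1 (by rwa [one_mul])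
    rw [(Ideal.eq_top_iff_one _).mpr h1, Ideal.top_pow]
    trivial
  have hn : 0 < n := i.pos
  obtain ⟨z, s, hzb, hs⟩ := exists_reduction_of_idealOfVars_pow_le hL hb
  set Z := Ideal.span (Set.range z) with hZ
  have hZb : Z ≤ b := Ideal.span_le.mpr (by rintro _ ⟨i, rfl⟩; exact hzb i)
  have hp : p.Prime := Fact.out
  set q := p ^ (m + s) with hq
  have hqle : m + s < q := Nat.lt_pow_self hp.one_lt
  have hq0 : 0 < q := by omega
  set J := b ^ (m - n) with hJ
  have hLJ : idealOfVars (Fin n) κ ^ (L * (m - n)) ≤ J := by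
    rw [pow_mul]; exact Ideal.pow_right_mono hL _
  obtain ⟨ψ, hψ0, hψ⟩ := exists_cartier_addMonoidHom (κ := κ) p (m + s)
    (Finsupp.single i (q - 1)) (fun j => by
      classical
      rw [Finsupp.single_apply]; split_ifs <;> omega)
  have hψu : (ψ (f ^ (q - 1))).coeff 0 ≠ 0 := by
    intro h
    have := hψ0 (f ^ (q - 1))
    rw [h, coeff_single_pow hf, zero_pow hq0.ne'] at this
    exact pow_ne_zero _ hi this.symm
  refine mem_of_mul_mem_of_idealOfVars_pow_le hLJ hψu ?_
  rw [← hψ]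
  set W := Ideal.span ((· ^ q) '' (J : Set (MvPolynomial (Fin n) κ))) with hW
  have hψW : ∀ x ∈ W, ψ x ∈ J := by
    intro x hx
    suffices ∀ r, ψ (r * x) ∈ J by simpa using this 1
    induction hx using Submodule.span_induction with
    | mem x hx =>
      obtain ⟨w, hw, rfl⟩ := hx
      intro r
      change ψ (r * w ^ q) ∈ J
      rw [mul_comm, hψ]
      exact J.mul_mem_right _ hw
    | zero => simp
    | add x y _ _ hx hy => intro r; rw [mul_add, map_add]; exact J.add_mem (hx r) (hy r)
    | smul a x _ hx => intro r; rw [smul_eq_mul, ← mul_assoc]; exact hx _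
  apply hψW
  have hfact : g ^ q * f ^ (q - 1) = g * (f * g) ^ (q - 1) := by
    obtain ⟨t, ht⟩ : ∃ t, q = t + 1 := ⟨q - 1, by omega⟩
    rw [ht, Nat.add_sub_cancel]; ring
  change g ^ q * _ ∈ W
  rw [hfact]
  refine W.mul_mem_left _ ?_
  have hmem : (f * g) ^ (q - 1) ∈ b ^ (s + (m - 1) * q) := by
    have h1 := Ideal.pow_mem_pow hfg (q - 1)
    rw [← pow_mul] at h1
    refine Ideal.pow_le_pow_right ?_ h1
    obtain ⟨t, ht⟩ : ∃ t, q = t + 1 := ⟨q - 1, by omega⟩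
    obtain ⟨m', rfl⟩ : ∃ m', m = m' + 1 := ⟨m - 1, by omega⟩
    rw [ht] at hqle ⊢
    simp only [Nat.add_sub_cancel]
    nlinarith
  have hmono : ∀ {I : Ideal (MvPolynomial (Fin n) κ)}, I ≤ J →
      Ideal.span ((· ^ q) '' (I : Set (MvPolynomial (Fin n) κ))) ≤ W :=
    fun h => Ideal.span_mono (Set.image_mono h)
  have hle : b ^ (s + (m - 1) * q) ≤ W := by
    refine (Ideal.pow_add_le_pow_add_pow_of_pow_succ_le hs ((m - 1) * q)
      (q * (L * (m - n)) + n * (q - 1))).trans (sup_le ?_ ?_)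
    · refine (Ideal.span_range_pow_le_span_frobenius z hq0 (j := m - n) ?_).trans
        (hmono (Ideal.pow_right_mono hZb _))
      obtain ⟨t, ht⟩ : ∃ t, q = t + 1 := ⟨q - 1, by omega⟩
      obtain ⟨m', rfl⟩ : ∃ m', m = n + m' := ⟨m - n, by omega⟩
      obtain ⟨n', rfl⟩ : ∃ n', n = n' + 1 := ⟨n - 1, by omega⟩
      rw [ht]
      have h2 : n' + 1 + m' - 1 = n' + m' := by omega
      simp only [Nat.add_sub_cancel, Nat.add_sub_cancel_left, h2]
      nlinarith
    · exact (Ideal.span_range_pow_le_span_frobenius X hq0 (by omega)).trans (hmono hLJ)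
  exact hle hmem

end MvPolynomial

theorem Int.isJacobsonRing : IsJacobsonRing ℤ := by
  refine isJacobsonRing_iff_prime_eq.mpr fun P hP => ?_
  rcases eq_or_ne P ⊥ with rfl | hP0
  · refine eq_bot_iff.mpr fun x hx => ?_
    rcases Int.isUnit_iff.mp (Ideal.mem_jacobson_bot.mp hx x) with h | h
    · simpa using h
    · nlinarith
  · have := hP.isMaximal hP0
    exact Ideal.jacobson_eq_self_of_isMaximal

theorem exists_ringHom_isAlgClosed_charP.{u} (A : Type u) [CommRing A] [Nontrivial A]
    [Algebra.FiniteType ℤ A] :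
    ∃ (p : ℕ) (κ : Type u) (_ : Field κ), IsAlgClosed κ ∧ p.Prime ∧ CharP κ p ∧
      Nonempty (A →+* κ) := by
  obtain ⟨M, hM⟩ := Ideal.exists_maximal A
  let _ : Field (A ⧸ M) := Ideal.Quotient.field M
  have hft : Algebra.FiniteType ℤ (A ⧸ M) :=
    Algebra.FiniteType.of_surjective (Ideal.Quotient.mkₐ ℤ M) (Ideal.Quotient.mkₐ_surjective ℤ M)
  have := Int.isJacobsonRing
  have hfin : Module.Finite ℤ (A ⧸ M) := finite_of_finite_type_of_isJacobsonRing ℤ (A ⧸ M)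
  obtain ⟨p, hp⟩ := CharP.exists (A ⧸ M)
  have hp0 : p ≠ 0 := by
    rintro rfl
    have : CharZero (A ⧸ M) := CharP.charP_to_charZero _
    exact Int.not_isField (isField_of_isIntegral_of_isField
      (RingHom.injective_int (algebraMap ℤ (A ⧸ M))) (Field.toIsField (A ⧸ M)))
  exact ⟨p, AlgebraicClosure (A ⧸ M), inferInstance, inferInstance,
    (CharP.char_is_prime_or_zero (A ⧸ M) p).resolve_right hp0,
    charP_of_injective_algebraMap (algebraMap (A ⧸ M) (AlgebraicClosure (A ⧸ M))).injective p,
    ⟨(algebraMap (A ⧸ M) (AlgebraicClosure (A ⧸ M))).comp (Ideal.Quotient.mk M)⟩⟩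

namespace MvPolynomial

theorem basisMonomials_constr_monomial {σ R : Type*} [CommRing R] (u : (σ →₀ ℕ) → R)
    (α : σ →₀ ℕ) (c : R) : (basisMonomials σ R).constr R u (monomial α c) = c * u α := by
  have : monomial α c = c • basisMonomials σ R α := by simp [coe_basisMonomials, smul_monomial]
  rw [this, map_smul, Module.Basis.constr_basis, smul_eq_mul]

theorem basisMonomials_constr_map {σ A B : Type*} [CommRing A] [CommRing B] (θ : A →+* B)
    (v : (σ →₀ ℕ) → A) (w : MvPolynomial σ A) :
    (basisMonomials σ B).constr B (fun α => θ (v α)) (map θ w) =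
      θ ((basisMonomials σ A).constr A v w) := by
  induction w using MvPolynomial.induction_on' with
  | monomial α c => simp only [map_monomial, basisMonomials_constr_monomial, map_mul]
  | add p q hp hq => simp only [map_add, hp, hq]

open scoped Pointwise in
theorem _root_.Set.Finite.set_pow {M : Type*} [Monoid M] {s : Set M} (hs : s.Finite) (m : ℕ) :
    (s ^ m).Finite := by
  induction m with
  | zero => simp
  | succ m ih => rw [pow_succ]; exact ih.mul hs

open scoped Pointwise in
theorem mem_pow_of_mul_mem_pow_of_idealOfVars_pow_le {k : Type*} [Field k] [CharZero k]
    {n L : ℕ} {b : Ideal (MvPolynomial (Fin n) k)}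
    (hL : idealOfVars (Fin n) k ^ L ≤ b) {f g : MvPolynomial (Fin n) k} (hf : f.coeff 0 = 0)
    {i : Fin n} (hi : f.coeff (Finsupp.single i 1) ≠ 0) {m : ℕ} (hm : n ≤ m)
    (hfg : f * g ∈ b ^ m) : g ∈ b ^ (m - n) := by
  classical
  by_contra hg
  have hLJ : idealOfVars (Fin n) k ^ (L * (m - n)) ≤ b ^ (m - n) := by
    rw [pow_mul]; exact Ideal.pow_right_mono hL _
  obtain ⟨φ, hφg, hφ⟩ := Submodule.exists_le_ker_of_notMem
    (p := (b ^ (m - n)).restrictScalars k) (v := g) (by simpa using hg)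
  obtain ⟨H₀, hH₀⟩ := IsNoetherian.noetherian b
  set H : Set (MvPolynomial (Fin n) k) := H₀ ∪ Set.range X ^ L with hH
  have hHfin : H.Finite := H₀.finite_toSet.union ((Set.finite_range _).set_pow _)
  have hHb : Ideal.span H = b := by
    refine le_antisymm (Ideal.span_le.mpr (Set.union_subset ?_ ?_)) ?_
    · rw [← hH₀]; exact Submodule.subset_span
    · refine Set.Subset.trans ?_ (SetLike.coe_subset_coe.mpr hL)
      rw [idealOfVars, Ideal.span, Submodule.span_pow]
      exact Submodule.subset_span
    · rw [← hH₀]; exact Submodule.span_mono Set.subset_union_left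
  have hTfin : (H ^ m).Finite := hHfin.set_pow m
  obtain ⟨c, hc⟩ : ∃ c : MvPolynomial (Fin n) k → MvPolynomial (Fin n) k,
      ∑ a ∈ hTfin.toFinset, c a • a = f * g := by
    rw [← hHb, Ideal.span, Submodule.span_pow, ← hTfin.coe_toFinset] at hfg
    obtain ⟨c, -, hc⟩ := Submodule.mem_span_finset.mp hfg
    exact ⟨c, hc⟩
  have hdegfin : {α : Fin n →₀ ℕ | α.degree < L * (m - n)}.Finite :=
    (Finsupp.finite_of_degree_le (L * (m - n))).subset fun α (hα : α.degree < _) => hα.le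
  let S₀ : Finset k := f.coeffs ∪ g.coeffs ∪ hHfin.toFinset.biUnion coeffs ∪
    hTfin.toFinset.biUnion (fun a => (c a).coeffs) ∪
    {(f.coeff (Finsupp.single i 1))⁻¹, (φ g)⁻¹, 0} ∪
    hdegfin.toFinset.image (fun α => φ (monomial α 1))
  set S : Set k := ↑S₀ with hS
  have hSfin : S.Finite := Finset.finite_toSet _
  let Λ := Algebra.adjoin ℤ S
  have hSΛ : ∀ x ∈ S, ∃ y : Λ, algebraMap Λ k y = x := fun x hx =>
    ⟨⟨x, Algebra.subset_adjoin hx⟩, rfl⟩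
  have hΛ : Algebra.FiniteType ℤ Λ :=
    Λ.fg_iff_finiteType.mp (Subalgebra.fg_def.mpr ⟨S, hSfin, rfl⟩)
  have hinj : Function.Injective (algebraMap Λ k) := Subtype.val_injective
  let ι : MvPolynomial (Fin n) Λ →+* MvPolynomial (Fin n) k := map (algebraMap Λ k)
  have hιinj : Function.Injective ι := map_injective _ hinj
  have hlift : ∀ q : MvPolynomial (Fin n) k, (q.coeffs : Set k) ⊆ S → ∃ Q, ι Q = q := by
    intro q hq
    have : q ∈ Set.range (map (algebraMap Λ k)) :=
      mem_range_map_iff_coeffs_subset.mpr fun x hx => hSΛ x (hq hx)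
    exact this
  obtain ⟨F, hF⟩ := hlift f fun x hx => by simp only [hS, S₀, Finset.coe_union]; simp_all
  obtain ⟨G, hG⟩ := hlift g fun x hx => by simp only [hS, S₀, Finset.coe_union]; simp_all
  have hHlift : H = ι '' (ι ⁻¹' H) := by
    rw [Set.image_preimage_eq_of_subset]
    intro h hh
    refine hlift h fun x hx => ?_
    simp only [hS, S₀, Finset.coe_union, Finset.coe_biUnion]
    refine .inl (.inl (.inl (.inr ?_)))
    exact Set.mem_biUnion (by simpa using hh) hx
  have hclift : ∀ a ∈ hTfin.toFinset, ∃ Q, ι Q = c a := by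
    intro a ha
    refine hlift _ fun x hx => ?_
    simp only [hS, S₀, Finset.coe_union, Finset.coe_biUnion]
    refine .inl (.inl (.inr ?_))
    exact Set.mem_biUnion (Finset.mem_coe.mpr ha) hx
  obtain ⟨fi, hfi⟩ := hSΛ (f.coeff (Finsupp.single i 1))⁻¹ (by simp [hS, S₀])
  obtain ⟨gi, hgi⟩ := hSΛ (φ g)⁻¹ (by simp [hS, S₀])
  have hvex : ∀ α : Fin n →₀ ℕ, ∃ y : Λ, algebraMap Λ k y = φ (monomial α 1) := by
    intro α
    apply hSΛ
    by_cases hα : α.degree < L * (m - n)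
    · simp only [hS, S₀, Finset.coe_union, Finset.coe_image]
      exact .inr ⟨α, by simpa using hα, rfl⟩
    · have : φ (monomial α 1) = 0 := hφ (hLJ (by
        rw [monomial_mem_pow_idealOfVars_iff _ _ one_ne_zero]; omega))
      simp [this, hS, S₀]
  choose v hv using hvex
  set I := Ideal.span (ι ⁻¹' H) with hI
  have hIb : ∀ {j : ℕ} {w}, w ∈ I ^ j → ι w ∈ b ^ j := by
    intro j w hw
    have := Ideal.mem_map_of_mem ι hw
    rwa [Ideal.map_pow, hI, Ideal.map_span, ← hHlift, hHb] at this
  have hFG : F * G ∈ I ^ m := by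
    have hT : ∀ a ∈ hTfin.toFinset, ∃ Q, ι Q = c a • a ∧ Q ∈ I ^ m := by
      intro a ha
      obtain ⟨Q, hQ⟩ := hclift a ha
      have ha' : a ∈ ι '' ((ι ⁻¹' H) ^ m) := by
        rw [Set.image_pow, ← hHlift]; exact hTfin.mem_toFinset.mp ha
      obtain ⟨A, hA, rfl⟩ := ha'
      refine ⟨Q * A, by rw [map_mul, hQ, smul_eq_mul], Ideal.mul_mem_left _ _ ?_⟩
      rw [hI, Ideal.span, Submodule.span_pow]
      exact Submodule.subset_span hA
    choose! Q hQ hQI using hT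
    have : F * G = ∑ a ∈ hTfin.toFinset, Q a := by
      apply hιinj
      rw [map_mul, hF, hG, ← hc, map_sum]
      exact Finset.sum_congr rfl fun a ha => (hQ a ha).symm
    rw [this]
    exact Ideal.sum_mem _ hQI
  have hLI : idealOfVars (Fin n) Λ ^ L ≤ I := by
    rw [idealOfVars, Ideal.span, Submodule.span_pow]
    refine Submodule.span_mono fun w hw => Or.inr ?_
    have := Set.mem_image_of_mem ι hw
    rw [Set.image_pow, ← Set.range_comp] at this
    convert this
    ext j
    simp [ι]
  obtain ⟨p, κ, _, hκ, hp, hchar, ⟨θ⟩⟩ := exists_ringHom_isAlgClosed_charP Λ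
  have : Fact p.Prime := ⟨hp⟩
  let θ' : MvPolynomial (Fin n) Λ →+* MvPolynomial (Fin n) κ := map θ
  have hLI' : idealOfVars (Fin n) κ ^ L ≤ I.map θ' := by
    have h1 : idealOfVars (Fin n) κ = (idealOfVars (Fin n) Λ).map θ' := by
      rw [idealOfVars, idealOfVars, Ideal.map_span, ← Set.range_comp]
      congr 2
      ext j
      simp [θ']
    rw [h1, ← Ideal.map_pow]
    exact Ideal.map_mono hLI
  have hmem : θ' G ∈ (I.map θ') ^ (m - n) := by
    refine mem_pow_of_mul_mem_pow_of_charP p hLI' (f := θ' F) (i := i) ?_ ?_ hm ?_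
    · rw [coeff_map]
      have : F.coeff 0 = 0 := hinj (by
        rw [← coeff_map]
        change coeff 0 (ι F) = _
        rw [hF, hf, map_zero])
      rw [this, map_zero]
    · have h1 : F.coeff (Finsupp.single i 1) * fi = 1 := hinj (by
        rw [map_mul, ← coeff_map, hfi]
        change coeff _ (ι F) * _ = _
        rw [hF, mul_inv_cancel₀ hi, map_one])
      have h2 := congrArg θ h1
      rw [map_mul, map_one] at h2
      rw [coeff_map]
      exact left_ne_zero_of_mul_eq_one h2
    · rw [← map_mul, ← Ideal.map_pow]
      exact Ideal.mem_map_of_mem _ hFG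
  rw [← Ideal.map_pow] at hmem
  set φΛ := (basisMonomials (Fin n) Λ).constr Λ v with hφΛ
  set φκ := (basisMonomials (Fin n) κ).constr κ (fun α => θ (v α)) with hφκ
  have hφι : ∀ w, algebraMap Λ k (φΛ w) = φ (ι w) := by
    intro w
    rw [hφΛ, ← basisMonomials_constr_map]
    refine LinearMap.congr_fun ?_ _
    refine (basisMonomials (Fin n) k).ext fun α => ?_
    rw [Module.Basis.constr_basis, hv, coe_basisMonomials]
  have hφI : ∀ w ∈ I ^ (m - n), φΛ w = 0 := by
    intro w hw
    apply hinj
    rw [hφι, map_zero]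
    exact hφ (hIb hw)
  have hvanish : ∀ x ∈ (I ^ (m - n)).map θ', φκ x = 0 := by
    intro x hx
    suffices ∀ r, φκ (r * x) = 0 by simpa using this 1
    induction hx using Submodule.span_induction with
    | mem x hx =>
      obtain ⟨w, hw, rfl⟩ := hx
      intro r
      induction r using MvPolynomial.induction_on' with
      | add r₁ r₂ h₁ h₂ => rw [add_mul, map_add, h₁, h₂, add_zero]
      | monomial α a =>
        have h1 : monomial α a * θ' w = a • θ' (monomial α 1 * w) := by
          simp only [map_mul, θ', map_monomial, map_one, smul_eq_C_mul, ← mul_assoc, C_mul_monomial,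
            mul_one]
        rw [h1, map_smul, basisMonomials_constr_map, ← hφΛ, hφI _ (Ideal.mul_mem_left _ _ hw),
          map_zero, smul_zero]
    | zero => simp
    | add x y _ _ hx hy => intro r; rw [mul_add, map_add, hx, hy, add_zero]
    | smul a x _ hx => intro r; rw [smul_eq_mul, ← mul_assoc]; exact hx _
  have h0 := hvanish _ hmem
  rw [basisMonomials_constr_map, ← hφΛ] at h0
  have h1 : φΛ G * gi = 1 := hinj (by
    rw [map_mul, hφι, hG, hgi, mul_inv_cancel₀ hφg, map_one])
  have h2 := congrArg θ h1
  rw [map_mul, h0, zero_mul, map_one] at h2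
  exact zero_ne_one h2

end MvPolynomial

theorem Ideal.add_pow_le_pow_add {R : Type*} [CommRing R] (A B : Ideal R) {t : ℕ} (ht : t ≠ 0) :
    (A + B) ^ t ≤ A ^ t + B := by
  obtain ⟨t, rfl⟩ := Nat.exists_eq_succ_of_ne_zero ht
  clear ht
  induction t with
  | zero => simp
  | succ t ih =>
    calc (A + B) ^ (t + 1 + 1) = (A + B) ^ (t + 1) * (A + B) := pow_succ _ _
      _ ≤ (A ^ (t + 1) + B) * (A + B) := Ideal.mul_mono_left ih
      _ = A ^ (t + 1) * A + B * (A ^ (t + 1) + A + B) := by ring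
      _ ≤ A ^ (t + 1 + 1) + B := by
        rw [← pow_succ]
        exact sup_le_sup le_rfl Ideal.mul_le_left

namespace MvPolynomial

/-- The automorphism of a polynomial ring translating the variables by a vector. -/
noncomputable def translate {σ R : Type*} [CommRing R] (a : σ → R) :
    MvPolynomial σ R →ₐ[R] MvPolynomial σ R :=
  aeval fun i => X i + C (a i)

section translate

variable {σ R : Type*} [CommRing R]

theorem translate_neg_translate (a : σ → R) (p : MvPolynomial σ R) :
    translate (-a) (translate a p) = p := by
  have : (translate (-a)).comp (translate a) = AlgHom.id R (MvPolynomial σ R) := by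
    ext i
    simp [translate, algHom_C]
  exact DFunLike.congr_fun this p

theorem coeff_zero_translate (a : σ → R) (p : MvPolynomial σ R) :
    coeff 0 (translate a p) = eval a p := by
  have : (aeval (0 : σ → R)).comp (translate a) = aeval a := by
    ext i
    simp [translate]
  have h := DFunLike.congr_fun this p
  simpa [← constantCoeff_eq, constantCoeff_eq, aeval_eq_eval] using h

theorem eval_translate_neg (a : σ → R) (p : MvPolynomial σ R) :
    eval a (translate (-a) p) = coeff 0 p := by
  have : (aeval a).comp (translate (-a)) = aeval (0 : σ → R) := by
    ext i
    simp [translate]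
  have h := DFunLike.congr_fun this p
  simpa [aeval_eq_eval, constantCoeff_eq] using h

theorem coeff_single_mul [DecidableEq σ] (p q : MvPolynomial σ R) (i : σ) :
    coeff (Finsupp.single i 1) (p * q) =
      coeff 0 p * coeff (Finsupp.single i 1) q + coeff (Finsupp.single i 1) p * coeff 0 q := by
  rw [coeff_mul, Finsupp.antidiagonal_single]
  simp [Finset.Nat.antidiagonal_succ]

theorem coeff_single_translate (a : σ → R) (p : MvPolynomial σ R) (i : σ) :
    coeff (Finsupp.single i 1) (translate a p) = eval a (pderiv i p) := by
  classical
  have h0 : (0 : σ →₀ ℕ) ≠ Finsupp.single i 1 := by simp [eq_comm]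
  induction p using MvPolynomial.induction_on with
  | C r => simp [translate, algHom_C, coeff_C, h0]
  | add p q hp hq => simp only [map_add, coeff_add, hp, hq]
  | mul_X p j hp =>
    rw [map_mul, coeff_single_mul, hp, coeff_zero_translate, coeff_zero_translate]
    simp [translate, pderiv_X, coeff_X, coeff_C, Pi.single_apply, Finsupp.single_left_inj, h0]
    split_ifs <;> simp <;> ring

end translate

theorem mem_pow_of_mul_mem_pow {k : Type*} [Field k] [IsAlgClosed k] [CharZero k] {n : ℕ}
    {f : MvPolynomial (Fin n) k}
    (hsmooth : ∀ x : Fin n → k, ¬ (eval x f = 0 ∧ ∀ i, eval x (pderiv i f) = 0))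
    {b : Ideal (MvPolynomial (Fin n) k)} {m : ℕ} (hm : n ≤ m) {g : MvPolynomial (Fin n) k}
    (hfg : f * g ∈ b ^ m) : g ∈ b ^ (m - n) := by
  by_contra hg
  set J := b ^ (m - n) with hJ
  have hmn : m - n ≠ 0 := fun h => hg (by rw [hJ, h]; simp)
  set K := Submodule.comap (LinearMap.toSpanSingleton (MvPolynomial (Fin n) k) _ g) J with hK
  have hKmem : ∀ r, r ∈ K ↔ r * g ∈ J := fun r => Iff.rfl
  have hKtop : K ≠ ⊤ := fun h => hg (by simpa using (hKmem 1).mp (h ▸ Submodule.mem_top))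
  obtain ⟨M, hM, hKM⟩ := Ideal.exists_le_maximal K hKtop
  obtain ⟨a, ha⟩ := isMaximal_iff_eq_vanishingIdeal_singleton.mp hM
  have hKa : ∀ r ∈ K, eval a r = 0 := by
    intro r hr
    have := hKM hr
    rw [ha, mem_vanishingIdeal_singleton_iff] at this
    simpa [aeval_eq_eval] using this
  set 𝔪 := idealOfVars (Fin n) k with h𝔪
  set Jτ := J.map (translate a) with hJτ
  have hback : ∀ w ∈ Jτ, translate (-a) w ∈ J := by
    intro w hw
    have : Jτ ≤ J.comap (translate (-a)) := by
      rw [hJτ, Ideal.map_le_iff_le_comap]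
      intro x hx
      simpa [translate_neg_translate] using hx
    exact this hw
  obtain ⟨L, hL⟩ : ∃ L, translate a g ∉ Jτ + 𝔪 ^ L := by
    by_contra! hall
    have hmem : Ideal.Quotient.mk Jτ (translate a g) ∈
        (⨅ i : ℕ, 𝔪 ^ i • ⊤ : Submodule (MvPolynomial (Fin n) k) (MvPolynomial (Fin n) k ⧸ Jτ)) := by
      rw [Submodule.mem_iInf]
      intro i
      obtain ⟨x, hx, y, hy, hxy⟩ := Submodule.mem_sup.mp (hall i)
      rw [← hxy, map_add, Ideal.Quotient.eq_zero_iff_mem.mpr hx, zero_add]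
      have : Ideal.Quotient.mk Jτ y = y • Ideal.Quotient.mk Jτ 1 := by
        change _ = Ideal.Quotient.mk Jτ (y * 1)
        rw [mul_one]
      rw [this]
      exact Submodule.smul_mem_smul hy Submodule.mem_top
    obtain ⟨⟨r, hr⟩, hrg⟩ := (Ideal.mem_iInf_smul_pow_eq_bot_iff _ _).mp hmem
    have h1 : r * translate a g - translate a g ∈ Jτ := Ideal.Quotient.eq.mp hrg
    have h2 : translate (-a) r - 1 ∈ K := by
      rw [hKmem, sub_mul, one_mul]
      simpa [translate_neg_translate] using hback _ h1
    have h3 := hKa _ h2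
    have hr0 : coeff 0 r = 0 := by
      rw [h𝔪, ← pow_one (idealOfVars (Fin n) k), mem_pow_idealOfVars_iff'] at hr
      exact hr 0 (by simp)
    rw [map_sub, eval_translate_neg, hr0] at h3
    simp at h3
  set b' := b.map (translate a) + 𝔪 ^ L with hb'
  have hLb' : 𝔪 ^ L ≤ b' := le_sup_right
  have hb'J : b' ^ (m - n) ≤ Jτ + 𝔪 ^ L := by
    rw [hJτ, hJ, Ideal.map_pow]
    exact Ideal.add_pow_le_pow_add _ _ hmn
  have hmul : translate a f * translate a g ∈ b' ^ m := by
    rw [← map_mul]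
    have := Ideal.mem_map_of_mem (translate a) hfg
    rw [Ideal.map_pow] at this
    exact Ideal.pow_right_mono le_sup_left m this
  refine hL (hb'J ?_)
  by_cases hf0 : coeff 0 (translate a f) = 0
  · have : ∃ i, coeff (Finsupp.single i 1) (translate a f) ≠ 0 := by
      by_contra! h
      exact hsmooth a ⟨by rwa [← coeff_zero_translate], fun i => by
        rw [← coeff_single_translate, h]⟩
    obtain ⟨i, hi⟩ := this
    exact mem_pow_of_mul_mem_pow_of_idealOfVars_pow_le hLb' hf0 hi hm hmul
  · refine Ideal.pow_le_pow_right (Nat.sub_le m n) ?_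
    refine mem_of_mul_mem_of_idealOfVars_pow_le (L := L * m) ?_ hf0 (by rwa [mul_comm])
    rw [pow_mul]; exact Ideal.pow_right_mono hLb' m

end MvPolynomial

/-- If `f ∈ k[x_1,…,x_n]` is a nonconstant polynomial defining a smooth hypersurface
(`f` and its partial derivatives have no common zero), then `n` is a uniform Artin–Rees
number for `f`: for every ideal `𝔟` and every `m ≥ n`, `𝔟^m ∩ (f) ⊆ 𝔟^{m-n}·(f)`. -/
theorem uniformArtinRees_smooth {k : Type*} [Field k] [IsAlgClosed k] [CharZero k] {n : ℕ}
    (f : MvPolynomial (Fin n) k) (hf : f.totalDegree ≠ 0)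
    (hsmooth : ∀ x : Fin n → k,
      ¬ (eval x f = 0 ∧ ∀ i, eval x (pderiv i f) = 0)) :
    ∀ (b : Ideal (MvPolynomial (Fin n) k)) (m : ℕ), n ≤ m →
      b ^ m ⊓ Ideal.span {f} ≤ b ^ (m - n) * Ideal.span {f} := by
  rintro b m hm x ⟨hx, hxf⟩
  obtain ⟨g, rfl⟩ := Ideal.mem_span_singleton'.mp hxf
  exact Ideal.mul_mem_mul (mem_pow_of_mul_mem_pow hsmooth hm (by rwa [mul_comm]))
    (Ideal.mem_span_singleton_self f)
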